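/- There exists δ ∈ (0, 1/4) such that, for the target shape P = (0,1)² \ ([1/4, 3/4] × [1/2 − δ, 1/2 + δ]) (a unit square with a thin rectangular slot removed), no finite sequence of snip and reset operations in the connected two-tool snip model leads from the initial configuration to a configuration in which T₁ and T₂ both realize P simultaneously. -/

import Mathlib

open Set

/-- The plane. -/
abbrev Plane := ℝ × ℝ

/-- A rigid motion of the plane: `g x = R x + v` with `R ∈ SO(2)`. -/
def IsRigidMotion (g : Plane → Plane) : Prop :=
  ∃ θ : ℝ, ∃ v : Plane, ∀ p : Plane,
    g p = (Real.cos θ * p.1 - Real.sin θ * p.2 + v.1,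
           Real.sin θ * p.1 + Real.cos θ * p.2 + v.2)

/-- The open unit square `(0,1)²`. -/
def UnitSq : Set Plane := Ioo (0:ℝ) 1 ×ˢ Ioo (0:ℝ) 1

/-- A tool `T` realizes the shape `P` if `T` is the image of `P` under a rigid motion. -/
def Realizes (T P : Set Plane) : Prop := ∃ g, IsRigidMotion g ∧ T = g '' P

/-- One operation (snip or reset) in the connected two-tool snip model:
a snip replaces a tool by a connected component of the result of the cut. -/
inductive CStep : Set Plane × Set Plane → Set Plane × Set Plane → Prop
  | snip1 (g : Plane → Plane) (hg : IsRigidMotion g) (T₁ T₂ : Set Plane) (x : Plane)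
      (hx : x ∈ T₁ \ closure (g '' T₂)) :
      CStep (T₁, T₂) (connectedComponentIn (T₁ \ closure (g '' T₂)) x, T₂)
  | snip2 (g : Plane → Plane) (hg : IsRigidMotion g) (T₁ T₂ : Set Plane) (x : Plane)
      (hx : x ∈ T₂ \ closure (g '' T₁)) :
      CStep (T₁, T₂) (T₁, connectedComponentIn (T₂ \ closure (g '' T₁)) x)
  | reset1 (T₁ T₂ : Set Plane) : CStep (T₁, T₂) (UnitSq, T₂)
  | reset2 (T₁ T₂ : Set Plane) : CStep (T₁, T₂) (T₁, UnitSq)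

/-- `CReach k c c'` : configuration `c'` is reachable from `c` by exactly `k` operations. -/
inductive CReach : ℕ → Set Plane × Set Plane → Set Plane × Set Plane → Prop
  | refl (c : Set Plane × Set Plane) : CReach 0 c c
  | step {k : ℕ} {c c' c'' : Set Plane × Set Plane} :
      CStep c c' → CReach k c' c'' → CReach (k + 1) c c''

/-- The unit square with a slot of half-width `1/8` removed. -/
def SlottedSq : Set Plane :=
  UnitSq \ (Icc (1/4 : ℝ) (3/4) ×ˢ Icc (1/2 - 1/8 : ℝ) (1/2 + 1/8))

/-- The squared Euclidean distance on the plane. -/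
def sqDist (p q : Plane) : ℝ := (p.1 - q.1) ^ 2 + (p.2 - q.2) ^ 2

theorem IsRigidMotion.continuous {g : Plane → Plane} (hg : IsRigidMotion g) : Continuous g := by
  obtain ⟨θ, v, h⟩ := hg
  rw [funext h]
  fun_prop

theorem IsRigidMotion.sqDist_eq {g : Plane → Plane} (hg : IsRigidMotion g) (p q : Plane) :
    sqDist (g p) (g q) = sqDist p q := by
  obtain ⟨θ, v, h⟩ := hg
  simp only [sqDist, h]
  linear_combination ((p.1 - q.1) ^ 2 + (p.2 - q.2) ^ 2) * Real.sin_sq_add_cos_sq θ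

theorem IsRigidMotion.injective {g : Plane → Plane} (hg : IsRigidMotion g) :
    Function.Injective g := by
  intro p q hpq
  have h := hg.sqDist_eq p q
  rw [hpq] at h
  simp only [sqDist, sub_self] at h
  ext <;> nlinarith [sq_nonneg (p.1 - q.1), sq_nonneg (p.2 - q.2)]

theorem isPreconnected_unitSq : IsPreconnected UnitSq :=
  isPreconnected_Ioo.prod isPreconnected_Ioo

theorem slottedSq_eq_union : SlottedSq =
    (Ioo (0:ℝ) (1/4) ×ˢ Ioo (0:ℝ) 1 ∪ Ioo (0:ℝ) 1 ×ˢ Ioo (0:ℝ) (3/8)) ∪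
      (Ioo (3/4:ℝ) 1 ×ˢ Ioo (0:ℝ) 1 ∪ Ioo (0:ℝ) 1 ×ˢ Ioo (5/8:ℝ) 1) := by
  ext ⟨x, y⟩
  simp only [SlottedSq, UnitSq, mem_sdiff, mem_union, mem_prod, mem_Ioo, mem_Icc]
  grind

theorem isPreconnected_slottedSq : IsPreconnected SlottedSq := by
  have box {a b c d : ℝ} : IsPreconnected (Ioo a b ×ˢ Ioo c d) :=
    isPreconnected_Ioo.prod isPreconnected_Ioo
  rw [slottedSq_eq_union]
  refine IsPreconnected.union ((1/8, 7/8) : Plane) ?_ ?_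
    (IsPreconnected.union ((1/8, 1/8) : Plane) ?_ ?_ box box)
    (IsPreconnected.union ((7/8, 7/8) : Plane) ?_ ?_ box box) <;>
  simp only [mem_union, mem_prod, mem_Ioo] <;> norm_num

theorem mem_closure_slottedSq {x y : ℝ} (hx : x = 0 ∨ x = 1) (hy : y ∈ Icc (0:ℝ) 1) :
    ((x, y) : Plane) ∈ closure SlottedSq := by
  rw [slottedSq_eq_union]
  rcases hx with rfl | rfl
  · refine closure_mono (s := Ioo (0:ℝ) (1/4) ×ˢ Ioo (0:ℝ) 1)
      (fun _ h => Or.inl (Or.inl h)) ?_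
    rw [closure_prod_eq, closure_Ioo (by norm_num), closure_Ioo (by norm_num)]
    exact ⟨by norm_num, hy⟩
  · refine closure_mono (s := Ioo (3/4:ℝ) 1 ×ˢ Ioo (0:ℝ) 1)
      (fun _ h => Or.inr (Or.inl h)) ?_
    rw [closure_prod_eq, closure_Ioo (by norm_num), closure_Ioo (by norm_num)]
    exact ⟨by norm_num, hy⟩

theorem not_realizes_unitSq_slottedSq : ¬ Realizes UnitSq SlottedSq := by
  rintro ⟨g, hg, h⟩
  have hmem {y : ℝ} (hy : y ∈ Ioo (0:ℝ) 1) (hy' : y ∉ Icc (1/2 - 1/8 : ℝ) (1/2 + 1/8)) :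
      g (1/2, y) ∈ UnitSq := by
    rw [h]
    exact mem_image_of_mem g ⟨⟨by norm_num, hy⟩, fun hs => hy' hs.2⟩
  have ha := hmem (y := 1/8) (by norm_num) (by norm_num)
  have hb := hmem (y := 7/8) (by norm_num) (by norm_num)
  have hmid : g (1/2, 1/2) ∈ UnitSq := by
    obtain ⟨θ, v, hv⟩ := hg
    rw [hv] at ha hb ⊢
    simp only [UnitSq, mem_prod, mem_Ioo] at ha hb ⊢
    refine ⟨⟨?_, ?_⟩, ?_, ?_⟩ <;> linarith [ha.1.1, ha.1.2, ha.2.1, ha.2.2, hb.1.1, hb.1.2,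
      hb.2.1, hb.2.2]
  rw [h] at hmid
  obtain ⟨p, hp, hpg⟩ := hmid
  rw [hg.injective hpg] at hp
  exact hp.2 (by norm_num)

/-- A rigid copy of the slotted square inside the unit square has the unit square as its hull. -/
theorem unitSq_subset_image {h : Plane → Plane} (hh : IsRigidMotion h)
    (hsub : h '' SlottedSq ⊆ UnitSq) : UnitSq ⊆ h '' UnitSq := by
  have hcl {x y : ℝ} (hx : x = 0 ∨ x = 1) (hy : y ∈ Icc (0:ℝ) 1) :
      h (x, y) ∈ Icc (0:ℝ) 1 ×ˢ Icc (0:ℝ) 1 := by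
    have := closure_mono hsub (image_closure_subset_closure_image hh.continuous
      (mem_image_of_mem h (mem_closure_slottedSq hx hy)))
    rwa [UnitSq, closure_prod_eq, closure_Ioo (by norm_num)] at this
  have h00 := hcl (x := 0) (y := 0) (by norm_num) (by norm_num)
  have h01 := hcl (x := 0) (y := 1) (by norm_num) (by norm_num)
  have h10 := hcl (x := 1) (y := 0) (by norm_num) (by norm_num)
  have h11 := hcl (x := 1) (y := 1) (by norm_num) (by norm_num)
  obtain ⟨θ, ⟨v, w⟩, hv⟩ := hh
  have hcs := Real.sin_sq_add_cos_sq θ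
  simp only [hv, mem_prod, mem_Icc] at h00 h01 h10 h11
  rintro ⟨a, b⟩ ⟨⟨ha0, ha1⟩, hb0, hb1⟩
  refine ⟨(Real.cos θ * (a - v) + Real.sin θ * (b - w),
    -Real.sin θ * (a - v) + Real.cos θ * (b - w)), ?_, ?_⟩
  · generalize Real.cos θ = c at *
    generalize Real.sin θ = s at *
    obtain ⟨⟨_, _⟩, _, _⟩ := h00
    obtain ⟨⟨_, _⟩, _, _⟩ := h01
    obtain ⟨⟨_, _⟩, _, _⟩ := h10
    obtain ⟨⟨_, _⟩, _, _⟩ := h11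
    have hadd : (c + s) ^ 2 ≤ 1 := by
      rw [sq_le_one_iff_abs_le_one, abs_le]; constructor <;> linarith
    have hsub : (c - s) ^ 2 ≤ 1 := by
      rw [sq_le_one_iff_abs_le_one, abs_le]; constructor <;> linarith
    have hmul : c * s = 0 := by nlinarith
    simp only [UnitSq, mem_prod, mem_Ioo] at *
    rcases mul_eq_zero.1 hmul with rfl | rfl
    · rcases sq_eq_one_iff.1 (by linarith : s ^ 2 = 1) with rfl | rfl <;>
        refine ⟨⟨?_, ?_⟩, ?_, ?_⟩ <;> linarith
    · rcases sq_eq_one_iff.1 (by linarith : c ^ 2 = 1) with rfl | rfl <;>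
        refine ⟨⟨?_, ?_⟩, ?_, ?_⟩ <;> linarith
  · rw [hv]
    ext
    · simp only
      linear_combination (a - v) * hcs
    · simp only
      linear_combination (b - w) * hcs

/-- A rigid motion is a homeomorphism of the plane. -/
theorem IsRigidMotion.exists_homeomorph {h : Plane → Plane} (hh : IsRigidMotion h) :
    ∃ e : Plane ≃ₜ Plane, ⇑e = h := by
  obtain ⟨θ, v, hv⟩ := id hh
  have hcs := Real.sin_sq_add_cos_sq θ
  refine ⟨{
    toFun := h
    invFun := fun q => (Real.cos θ * (q.1 - v.1) + Real.sin θ * (q.2 - v.2),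
      -Real.sin θ * (q.1 - v.1) + Real.cos θ * (q.2 - v.2))
    left_inv := fun p => ?_
    right_inv := fun q => ?_
    continuous_toFun := hh.continuous
    continuous_invFun := by fun_prop }, rfl⟩
  · ext <;> simp only [hv]
    · linear_combination p.1 * hcs
    · linear_combination p.2 * hcs
  · ext <;> simp only [hv]
    · linear_combination (q.1 - v.1) * hcs
    · linear_combination (q.2 - v.2) * hcs

theorem IsRigidMotion.surjective {h : Plane → Plane} (hh : IsRigidMotion h) :
    Function.Surjective h := by
  obtain ⟨e, rfl⟩ := hh.exists_homeomorph
  exact e.surjective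

theorem IsRigidMotion.isClosed_image {h : Plane → Plane} (hh : IsRigidMotion h)
    {s : Set Plane} (hs : IsClosed s) : IsClosed (h '' s) := by
  obtain ⟨e, rfl⟩ := hh.exists_homeomorph
  exact e.isClosedMap s hs

/-- A snip with a slotted square that produces a slotted square removes nothing. -/
theorem realizes_of_snip {T₁ T₂ : Set Plane} {g : Plane → Plane} {x : Plane}
    (hg : IsRigidMotion g) (hsub : T₁ ⊆ UnitSq) (hconn : IsPreconnected T₁)
    (hx : x ∈ T₁ \ closure (g '' T₂)) (hT₂ : Realizes T₂ SlottedSq)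
    (hK : Realizes (connectedComponentIn (T₁ \ closure (g '' T₂)) x) SlottedSq) :
    Realizes T₁ SlottedSq := by
  obtain ⟨f, hf, rfl⟩ := hT₂
  obtain ⟨h, hh, hKh⟩ := id hK
  set S := closure (g '' (f '' SlottedSq)) with hS
  have hKsub : h '' SlottedSq ⊆ T₁ \ S := hKh ▸ connectedComponentIn_subset _ _
  have hSconn : IsPreconnected S :=
    ((isPreconnected_slottedSq.image f hf.continuous.continuousOn).image g
      hg.continuous.continuousOn).closure
  have hhull := unitSq_subset_image hh fun y hy => hsub (hKsub hy).1
  have hdisj : Disjoint S T₁ := by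
    rw [Set.disjoint_left]
    intro y hyS hyT
    obtain ⟨q, hq, rfl⟩ := hhull (hsub hyT)
    have hslot : IsClosed (h '' (Icc (1/4 : ℝ) (3/4) ×ˢ Icc (1/2 - 1/8 : ℝ) (1/2 + 1/8))) :=
      hh.isClosed_image (isClosed_Icc.prod isClosed_Icc)
    have hout : IsClosed (h '' UnitSqᶜ) :=
      hh.isClosed_image (isOpen_Ioo.prod isOpen_Ioo).isClosed_compl
    have hcover : S ⊆ h '' (Icc (1/4 : ℝ) (3/4) ×ˢ Icc (1/2 - 1/8 : ℝ) (1/2 + 1/8)) ∪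
        h '' UnitSqᶜ := by
      intro z hz
      obtain ⟨p, rfl⟩ := hh.surjective z
      by_cases hpU : p ∈ UnitSq
      · by_contra hcon
        exact (hKsub (mem_image_of_mem h
          ⟨hpU, fun hp => hcon (Or.inl (mem_image_of_mem h hp))⟩)).2 hz
      · exact Or.inr (mem_image_of_mem h hpU)
    have hinter : S ∩ (h '' (Icc (1/4 : ℝ) (3/4) ×ˢ Icc (1/2 - 1/8 : ℝ) (1/2 + 1/8)) ∩
        h '' UnitSqᶜ) = ∅ := by
      rw [← image_inter hh.injective, eq_empty_iff_forall_notMem]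
      rintro _ ⟨-, p, ⟨⟨⟨_, _⟩, _, _⟩, hpU⟩, rfl⟩
      exact hpU ⟨⟨by linarith, by linarith⟩, by linarith, by linarith⟩
    rcases isPreconnected_iff_subset_of_disjoint_closed.1 hSconn _ _ hslot hout hcover hinter
      with hin | hin
    · have hmem (a : ℝ) (ha : a ∈ Ioo (0:ℝ) (1/4) ∪ Ioo (3/4:ℝ) 1) :
          ∃ p ∈ Icc (1/4 : ℝ) (3/4) ×ˢ Icc (1/2 - 1/8 : ℝ) (1/2 + 1/8),
            h p = g (f (a, a)) := by
        refine hin (subset_closure (mem_image_of_mem g (mem_image_of_mem f ?_)))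
        simp only [SlottedSq, UnitSq, mem_sdiff, mem_union, mem_prod, mem_Ioo, mem_Icc] at ha ⊢
        grind
      obtain ⟨p, ⟨⟨_, _⟩, _, _⟩, hpg⟩ := hmem (1/8) (by norm_num)
      obtain ⟨r, ⟨⟨_, _⟩, _, _⟩, hrg⟩ := hmem (7/8) (by norm_num)
      have hd := hh.sqDist_eq p r
      rw [hpg, hrg, hg.sqDist_eq, hf.sqDist_eq] at hd
      have h1 : (p.1 - r.1) ^ 2 ≤ (1/2) ^ 2 := by
        apply sq_le_sq'
        all_goals linarith
      have h2 : (p.2 - r.2) ^ 2 ≤ (1/4) ^ 2 := by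
        apply sq_le_sq'
        all_goals linarith
      norm_num [sqDist] at hd
      linarith
    · obtain ⟨p, hp, hpq⟩ := hin hyS
      exact hp (hh.injective hpq ▸ hq)
  have hdiff : T₁ \ S = T₁ := hdisj.symm.sdiff_eq_left
  rw [hdiff] at hK hx
  rwa [hconn.connectedComponentIn hx] at hK

/-- Both tools are connected pieces of the unit square and not both are slotted squares. -/
def NotBothSlotted (c : Set Plane × Set Plane) : Prop :=
  (c.1 ⊆ UnitSq ∧ IsPreconnected c.1) ∧ (c.2 ⊆ UnitSq ∧ IsPreconnected c.2) ∧
    ¬ (Realizes c.1 SlottedSq ∧ Realizes c.2 SlottedSq)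

theorem CStep.notBothSlotted {c c' : Set Plane × Set Plane} (h : CStep c c')
    (hc : NotBothSlotted c) : NotBothSlotted c' := by
  obtain ⟨h₁, h₂, hn⟩ := hc
  cases h with
  | snip1 g hg T₁ T₂ x hx =>
    exact ⟨⟨(connectedComponentIn_subset _ _).trans (sdiff_subset.trans h₁.1),
      isPreconnected_connectedComponentIn⟩, h₂,
      fun hr => hn ⟨realizes_of_snip hg h₁.1 h₁.2 hx hr.2 hr.1, hr.2⟩⟩
  | snip2 g hg T₁ T₂ x hx =>
    exact ⟨h₁, ⟨(connectedComponentIn_subset _ _).trans (sdiff_subset.trans h₂.1),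
      isPreconnected_connectedComponentIn⟩,
      fun hr => hn ⟨hr.1, realizes_of_snip hg h₂.1 h₂.2 hx hr.1 hr.2⟩⟩
  | reset1 T₁ T₂ =>
    exact ⟨⟨Subset.rfl, isPreconnected_unitSq⟩, h₂,
      fun hr => not_realizes_unitSq_slottedSq hr.1⟩
  | reset2 T₁ T₂ =>
    exact ⟨h₁, ⟨Subset.rfl, isPreconnected_unitSq⟩,
      fun hr => not_realizes_unitSq_slottedSq hr.2⟩

theorem CReach.notBothSlotted {k : ℕ} {c c' : Set Plane × Set Plane} (h : CReach k c c')
    (hc : NotBothSlotted c) : NotBothSlotted c' := by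
  induction h with
  | refl => exact hc
  | step hs _ ih => exact ih (hs.notBothSlotted hc)

theorem stmt1 :
    ∃ δ : ℝ, δ ∈ Ioo (0:ℝ) (1/4) ∧
      ∀ (k : ℕ) (T₁ T₂ : Set Plane),
        CReach k (UnitSq, UnitSq) (T₁, T₂) →
        ¬ (Realizes T₁
              (UnitSq \ (Icc (1/4 : ℝ) (3/4) ×ˢ Icc (1/2 - δ) (1/2 + δ))) ∧
           Realizes T₂
              (UnitSq \ (Icc (1/4 : ℝ) (3/4) ×ˢ Icc (1/2 - δ) (1/2 + δ)))) := by
  refine ⟨1/8, by norm_num, fun k T₁ T₂ h => ?_⟩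
  exact (h.notBothSlotted ⟨⟨Subset.rfl, isPreconnected_unitSq⟩,
    ⟨Subset.rfl, isPreconnected_unitSq⟩, fun hr => not_realizes_unitSq_slottedSq hr.1⟩).2.2
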